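/- arXiv:2410.01405 — 5 statements merged into one kernel-verified Lean document; each statement's English description precedes it below -/
import Mathlib

section
/- Let t₁, t₂ ∈ ℝ and 0 < ε < t₂ − t₁. Define rect(x) = ReLU((x−t₁+ε)/ε) − ReLU((x−t₁)/ε) + ReLU((−x+t₂)/ε) − ReLU((−x+t₂−ε)/ε) − 1. Then rect(x) = 1 for every x ∈ [t₁, t₂−ε], and rect(x) = 0 for every x ∈ (−∞, t₁−ε] ∪ [t₂, ∞). -/
/-- ReLU activation. -/
def relu (x : ℝ) : ℝ := max x 0

theorem relu_of_nonneg {x : ℝ} (hx : 0 ≤ x) : relu x = x := max_eq_left hx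

theorem relu_of_nonpos {x : ℝ} (hx : x ≤ 0) : relu x = 0 := max_eq_right hx

/-- The ramp `y ↦ relu ((y + ε) / ε) - relu (y / ε)` equals `1` on `[0, ∞)`. -/
theorem relu_ramp_eq_one {y ε : ℝ} (hε : 0 < ε) (hy : 0 ≤ y) :
    relu ((y + ε) / ε) - relu (y / ε) = 1 := by
  rw [relu_of_nonneg (by positivity), relu_of_nonneg (by positivity), ← sub_div,
    add_sub_cancel_left, div_self hε.ne']

/-- The ramp `y ↦ relu ((y + ε) / ε) - relu (y / ε)` vanishes on `(-∞, -ε]`. -/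
theorem relu_ramp_eq_zero {y ε : ℝ} (hε : 0 < ε) (hy : y ≤ -ε) :
    relu ((y + ε) / ε) - relu (y / ε) = 0 := by
  rw [relu_of_nonpos (div_nonpos_of_nonpos_of_nonneg (by linarith) hε.le),
    relu_of_nonpos (div_nonpos_of_nonpos_of_nonneg (by linarith) hε.le), sub_zero]

/-- the four-ReLU rectangular function equals 1 on `[t₁, t₂ - ε]`
and equals 0 on `(-∞, t₁ - ε] ∪ [t₂, ∞)`, whenever `0 < ε < t₂ - t₁`. -/
theorem rect_function (t₁ t₂ ε : ℝ) (hε : 0 < ε) (hεlt : ε < t₂ - t₁) :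
    (∀ x : ℝ, x ∈ Set.Icc t₁ (t₂ - ε) →
      relu ((x - t₁ + ε) / ε) - relu ((x - t₁) / ε)
        + relu ((-x + t₂) / ε) - relu ((-x + t₂ - ε) / ε) - 1 = 1) ∧
    (∀ x : ℝ, x ≤ t₁ - ε ∨ t₂ ≤ x →
      relu ((x - t₁ + ε) / ε) - relu ((x - t₁) / ε)
        + relu ((-x + t₂) / ε) - relu ((-x + t₂ - ε) / ε) - 1 = 0) := by
  have falling_one (x : ℝ) (hx : x ≤ t₂ - ε) :
      relu ((-x + t₂) / ε) - relu ((-x + t₂ - ε) / ε) = 1 := by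
    simpa using relu_ramp_eq_one (y := -x + t₂ - ε) hε (by linarith)
  have falling_zero (x : ℝ) (hx : t₂ ≤ x) :
      relu ((-x + t₂) / ε) - relu ((-x + t₂ - ε) / ε) = 0 := by
    simpa using relu_ramp_eq_zero (y := -x + t₂ - ε) hε (by linarith)
  refine ⟨fun x ⟨h₁, h₂⟩ => ?_, fun x hx => ?_⟩
  · linarith [relu_ramp_eq_one hε (sub_nonneg.2 h₁), falling_one x h₂]
  · rcases hx with hx | hx
    · linarith [relu_ramp_eq_zero (y := x - t₁) hε (by linarith), falling_one x (by linarith)]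
    · linarith [relu_ramp_eq_one (y := x - t₁) hε (by linarith), falling_zero x hx]
end

section
/- Let θ ∈ ℕ and M > 0. Define impulse(x,t) = ReLU(x + 2M(t−θ+1/2)) − 2M·ReLU(t−θ+1/2) − ReLU(x + 2M(t−θ−1/2)) + 2M·ReLU(t−θ−1/2). Then for every x ∈ [−M, M] and every t ∈ ℕ: impulse(x,t) = x if t = θ, and impulse(x,t) = 0 if t ≠ θ. -/
/-- Above the threshold `1 / 2` the shifted ReLU is the identity up to the shift. -/
lemma relu_add_mul_of_half_le {M x s : ℝ} (hM : 0 < M) (hx : -M ≤ x) (hs : 1 / 2 ≤ s) :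
    relu (x + 2 * M * s) = x + 2 * M * relu s := by
  have hpos : 0 ≤ x + 2 * M * s := by nlinarith
  have hs' : 0 ≤ s := by linarith
  simp only [relu, max_eq_left hpos, max_eq_left hs']

/-- Below the threshold `-1 / 2` the shifted ReLU vanishes. -/
lemma relu_add_mul_of_le_neg_half {M x s : ℝ} (hM : 0 < M) (hx : x ≤ M) (hs : s ≤ -(1 / 2)) :
    relu (x + 2 * M * s) = 2 * M * relu s := by
  have hneg : x + 2 * M * s ≤ 0 := by nlinarith
  have hs' : s ≤ 0 := by linarith
  simp only [relu, max_eq_right hneg, max_eq_right hs', mul_zero]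

/-- the four-ReLU impulse function satisfies
`impulse(x,t) = x` if `t = θ` and `impulse(x,t) = 0` otherwise,
for all `x ∈ [−M, M]` and `t ∈ ℕ`. -/
theorem impulse_function (θ : ℕ) (M : ℝ) (hM : 0 < M) :
    ∀ x : ℝ, x ∈ Set.Icc (-M) M → ∀ t : ℕ,
      (t = θ →
        relu (x + 2 * M * ((t : ℝ) - (θ : ℝ) + 1 / 2))
          - 2 * M * relu ((t : ℝ) - (θ : ℝ) + 1 / 2)
          - relu (x + 2 * M * ((t : ℝ) - (θ : ℝ) - 1 / 2))
          + 2 * M * relu ((t : ℝ) - (θ : ℝ) - 1 / 2) = x) ∧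
      (t ≠ θ →
        relu (x + 2 * M * ((t : ℝ) - (θ : ℝ) + 1 / 2))
          - 2 * M * relu ((t : ℝ) - (θ : ℝ) + 1 / 2)
          - relu (x + 2 * M * ((t : ℝ) - (θ : ℝ) - 1 / 2))
          + 2 * M * relu ((t : ℝ) - (θ : ℝ) - 1 / 2) = 0) := by
  rintro x ⟨hl, hu⟩ t
  refine ⟨?_, fun hne => ?_⟩
  · rintro rfl
    rw [relu_add_mul_of_half_le hM hl (by linarith), relu_add_mul_of_le_neg_half hM hu (by linarith)]
    ring
  · rcases lt_or_gt_of_ne hne with h | h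
    · have h' : (t : ℝ) + 1 ≤ θ := by exact_mod_cast h
      rw [relu_add_mul_of_le_neg_half hM hu (by linarith),
        relu_add_mul_of_le_neg_half hM hu (by linarith)]
      ring
    · have h' : (θ : ℝ) + 1 ≤ t := by exact_mod_cast h
      rw [relu_add_mul_of_half_le hM hl (by linarith), relu_add_mul_of_half_le hM hl (by linarith)]
      ring
end

section
/- Let d ∈ ℕ, let n ∈ ℕ with n ≥ 2, set δ = 1/n, and let 0 < ε < δ. Then there exist a feed-forward layer FF: ℝ^{5d} → ℝ^{5d} of width 7d whose weight entries all have absolute value at most 1/ε, and two affine maps L₁: ℝ^d → ℝ^{5d}, L₂: ℝ^{5d} → ℝ^d, such that for every x ∈ ℝ^d, every i ∈ {1,…,d}, and every k ∈ {0,1,…,n−1}: if x_i ∈ [kδ, (k+1)δ − ε], then (L₂ ∘ (id + FF)^{∘(n−1)} ∘ L₁(x))_i = k. -/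
noncomputable section

/-- Parameters of a feed-forward layer `FF(x) = W₂·ReLU(W₁x + b₁) + b₂`
of width `q` on `ℝ^m`. -/
structure FFParams (m q : ℕ) where
  W1 : Matrix (Fin q) (Fin m) ℝ
  W2 : Matrix (Fin m) (Fin q) ℝ
  b1 : Fin q → ℝ
  b2 : Fin m → ℝ

/-- Application of a feed-forward layer. -/
def FFParams.apply {m q : ℕ} (P : FFParams m q) (x : Fin m → ℝ) : Fin m → ℝ :=
  P.W2.mulVec (fun j => relu (P.W1.mulVec x j + P.b1 j)) + P.b2

end

/-- The layer acting on the `i`-th block `(t, s, …)` by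
`FF(t, s, …) = (-c, ReLU(t + 1) - ReLU(t), 0, …)`. -/
noncomputable def stepLayer (d : ℕ) (c : ℝ) : FFParams (5 * d) (7 * d) where
  W1 := Matrix.of fun q p =>
    if (finProdFinEquiv.symm p).1 = 0 ∧ (finProdFinEquiv.symm p).2 = (finProdFinEquiv.symm q).2
    then 1 else 0
  W2 := Matrix.of fun p q =>
    if (finProdFinEquiv.symm p).1 = 1 ∧ (finProdFinEquiv.symm q).2 = (finProdFinEquiv.symm p).2
    then (if (finProdFinEquiv.symm q).1 = 0 then 1
      else if (finProdFinEquiv.symm q).1 = 1 then -1 else 0)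
    else 0
  b1 := fun q => if (finProdFinEquiv.symm q).1 = 0 then 1 else 0
  b2 := fun p => if (finProdFinEquiv.symm p).1 = 0 then -c else 0

/-- Summing over `Fin (a * d)` amounts to summing over blocks and coordinates. -/
theorem sum_finProdFin {a d : ℕ} (f : Fin (a * d) → ℝ) :
    ∑ p, f p = ∑ i : Fin d, ∑ r : Fin a, f (finProdFinEquiv (r, i)) := by
  rw [← finProdFinEquiv.sum_comp f, Fintype.sum_prod_type_right]

theorem stepLayer_W1_mulVec {d : ℕ} (c : ℝ) (v : Fin (5 * d) → ℝ) (q : Fin (7 * d)) :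
    (stepLayer d c).W1.mulVec v q = v (finProdFinEquiv (0, (finProdFinEquiv.symm q).2)) := by
  simp only [Matrix.mulVec, dotProduct, sum_finProdFin, stepLayer, Matrix.of_apply,
    Equiv.symm_apply_apply, ite_and, ite_mul, one_mul, zero_mul]
  simp

theorem stepLayer_apply_zero {d : ℕ} (c : ℝ) (v : Fin (5 * d) → ℝ) (i : Fin d) :
    (stepLayer d c).apply v (finProdFinEquiv (0, i)) = -c := by
  simp [FFParams.apply, stepLayer, Matrix.mulVec, dotProduct, -finProdFinEquiv_symm_apply]

theorem stepLayer_apply_one {d : ℕ} (c : ℝ) (v : Fin (5 * d) → ℝ) (i : Fin d) :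
    (stepLayer d c).apply v (finProdFinEquiv (1, i)) =
      relu (v (finProdFinEquiv (0, i)) + 1) - relu (v (finProdFinEquiv (0, i))) := by
  simp only [FFParams.apply, stepLayer_W1_mulVec, Pi.add_apply]
  simp only [Matrix.mulVec, dotProduct, sum_finProdFin, stepLayer, Matrix.of_apply,
    Equiv.symm_apply_apply]
  rw [Finset.sum_eq_single i (fun j _ hj => by simp [hj]) (by simp), Fin.sum_univ_seven]
  simp [sub_eq_add_neg]

/-- Iterating the layer on a block with first entry `(x - δ) / ε` and second entry `0`
counts the thresholds `δ, 2δ, …` that lie below `x`. -/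
theorem stepLayer_iterate {d : ℕ} {ε δ x : ℝ} (hε : 0 < ε) (hδ : 0 ≤ δ) {k : ℕ}
    (hx : x ∈ Set.Icc (k * δ) ((k + 1) * δ - ε)) (v : Fin (5 * d) → ℝ) (i : Fin d)
    (h0 : v (finProdFinEquiv (0, i)) = (x - δ) / ε) (h1 : v (finProdFinEquiv (1, i)) = 0)
    (m : ℕ) :
    (fun v => v + (stepLayer d (δ / ε)).apply v)^[m] v (finProdFinEquiv (0, i))
        = (x - (m + 1) * δ) / ε ∧
      (fun v => v + (stepLayer d (δ / ε)).apply v)^[m] v (finProdFinEquiv (1, i))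
        = (min m k : ℕ) := by
  induction m with
  | zero => simp [h0, h1]
  | succ m ih =>
    obtain ⟨ht, hs⟩ := ih
    simp only [Function.iterate_succ_apply', Pi.add_apply, stepLayer_apply_zero,
      stepLayer_apply_one, ht, hs]
    refine ⟨by push_cast; ring, ?_⟩
    rcases Nat.lt_or_ge m k with hmk | hmk
    · have hcast : (m : ℝ) + 1 ≤ k := by exact_mod_cast hmk
      have hpos : 0 ≤ (x - (m + 1) * δ) / ε :=
        div_nonneg (by nlinarith [hx.1]) hε.le
      rw [relu, relu, max_eq_left (by linarith), max_eq_left hpos, min_eq_left hmk.le,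
        min_eq_left hmk]
      push_cast
      ring
    · have hcast : (k : ℝ) ≤ m := by exact_mod_cast hmk
      have hneg : (x - (m + 1) * δ) / ε ≤ -1 := by
        rw [div_le_iff₀ hε]
        nlinarith [hx.2]
      rw [relu, relu, max_eq_right (by linarith), max_eq_right (by linarith),
        min_eq_right hmk, min_eq_right (by lia)]
      ring

/-- quantization: with `δ = 1/n`, `n ≥ 2`, `0 < ε < δ`, there
exist a feed-forward layer `FF : ℝ^{5d} → ℝ^{5d}` of width `7d` with all weight
entries bounded by `1/ε` in absolute value, and affine maps
`L₁ : ℝ^d → ℝ^{5d}`, `L₂ : ℝ^{5d} → ℝ^d`, such that whenever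
`x_i ∈ [kδ, (k+1)δ − ε]` with `k < n`, the `i`-th output coordinate of
`L₂ ∘ (id+FF)^{∘(n−1)} ∘ L₁` equals `k`. -/
theorem quantization (d n : ℕ) (hn : 2 ≤ n) (ε : ℝ) (hε : 0 < ε)
    (hεδ : ε < 1 / (n : ℝ)) :
    ∃ (P : FFParams (5 * d) (7 * d))
      (A1 : Matrix (Fin (5 * d)) (Fin d) ℝ) (b1 : Fin (5 * d) → ℝ)
      (A2 : Matrix (Fin d) (Fin (5 * d)) ℝ) (b2 : Fin d → ℝ),
      ((∀ i j, |P.W1 i j| ≤ 1 / ε) ∧ (∀ i j, |P.W2 i j| ≤ 1 / ε) ∧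
        (∀ i, |P.b1 i| ≤ 1 / ε) ∧ (∀ i, |P.b2 i| ≤ 1 / ε)) ∧
      ∀ x : Fin d → ℝ, ∀ i : Fin d, ∀ k : ℕ, k < n →
        x i ∈ Set.Icc ((k : ℝ) * (1 / (n : ℝ)))
          (((k : ℝ) + 1) * (1 / (n : ℝ)) - ε) →
        A2.mulVec ((fun v => v + P.apply v)^[n - 1] (A1.mulVec x + b1)) i + b2 i
          = (k : ℝ) := by
  have hn1 : (1 : ℝ) ≤ n := by exact_mod_cast (by lia : 1 ≤ n)
  have hδ0 : (0 : ℝ) ≤ 1 / n := by positivity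
  have hδ1 : (1 : ℝ) / n ≤ 1 := by rw [div_le_one (by linarith)]; exact hn1
  have hone : 1 ≤ 1 / ε := by rw [le_div_iff₀ hε]; linarith
  have hzero : 0 ≤ 1 / ε := by linarith
  have hbias : |1 / (n : ℝ) / ε| ≤ 1 / ε := by
    rw [abs_of_nonneg (by positivity)]
    gcongr
  refine ⟨stepLayer d (1 / n / ε),
    Matrix.of fun p j => if p = finProdFinEquiv (0, j) then 1 / ε else 0,
    fun p => if (finProdFinEquiv.symm p).1 = 0 then -(1 / n / ε) else 0,
    Matrix.of fun i p => if p = finProdFinEquiv (1, i) then 1 else 0, 0,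
    ⟨fun q p => ?_, fun p q => ?_, fun q => ?_, fun p => ?_⟩, fun x i k hk hx => ?_⟩
  · simp only [stepLayer, Matrix.of_apply]
    split_ifs <;> simpa only [abs_one, abs_zero]
  · simp only [stepLayer, Matrix.of_apply]
    split_ifs <;> simpa only [abs_neg, abs_one, abs_zero]
  · simp only [stepLayer]
    split_ifs <;> simpa only [abs_one, abs_zero]
  · simp only [stepLayer]
    split_ifs <;> simpa only [abs_neg, abs_zero]
  · have hiter := stepLayer_iterate (d := d) hε hδ0 hx
    specialize hiter ((Matrix.of fun p j => if p = finProdFinEquiv (0, j) then 1 / ε else 0).mulVec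
      x + fun p => if (finProdFinEquiv.symm p).1 = 0 then -(1 / n / ε) else 0) i
      (by simp [Matrix.mulVec, dotProduct, -finProdFinEquiv_symm_apply]; ring)
      (by simp [Matrix.mulVec, dotProduct, -finProdFinEquiv_symm_apply]) (n - 1)
    rw [min_eq_right (by lia)] at hiter
    simpa [Matrix.mulVec, dotProduct] using hiter.2
end

section
/- Let N, K ∈ ℕ with K ≥ N ≥ 1, and let u = (K^{N−1}, K^{N−2}, …, K, 1)ᵀ ∈ ℝ^N. Then there exist a Transformer block TF: ℝ^{5×N} → ℝ^{5×N} with hardmax attention having a single head, head size 1, and feed-forward width 3, and two token-wise affine maps L₁: ℝ → ℝ^5 and L₂: ℝ^5 → ℝ, such that for every strictly decreasing tuple z ∈ {0,1,…,K−1}^N (i.e., z₁ > z₂ > ⋯ > z_N), L₂ ∘ TF^{∘N} ∘ L₁ applied to the row vector zᵀ ∈ ℝ^{1×N} equals (uᵀz)·1_Nᵀ, i.e., every output entry equals Σ_{n=1}^N z_n K^{N−n}. -/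
open scoped BigOperators
open MeasureTheory Matrix

noncomputable section

/-- Parameters of a self-attention layer with `h` heads and head size `s`
on `ℝ^{m×N}`. -/
structure AttnParams (m s h : ℕ) where
  WO : Fin h → Matrix (Fin m) (Fin s) ℝ
  WV : Fin h → Matrix (Fin s) (Fin m) ℝ
  WK : Fin h → Matrix (Fin s) (Fin m) ℝ
  WQ : Fin h → Matrix (Fin s) (Fin m) ℝ

/-- Apply a column map `σ` (e.g. softmax or hardmax) to each column of a
square matrix. -/
def colwise {N : ℕ} (σ : (Fin N → ℝ) → (Fin N → ℝ))
    (A : Matrix (Fin N) (Fin N) ℝ) : Matrix (Fin N) (Fin N) ℝ :=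
  Matrix.of fun i j => σ (fun k => A k j) i

/-- Self-attention: `Attn(X) = Σᵢ W_O^i W_V^i X σ[(W_K^i X)ᵀ W_Q^i X]`,
with `σ` applied columnwise. -/
def AttnParams.apply {m s h N : ℕ} (P : AttnParams m s h)
    (σ : (Fin N → ℝ) → (Fin N → ℝ)) (X : Matrix (Fin m) (Fin N) ℝ) :
    Matrix (Fin m) (Fin N) ℝ :=
  ∑ i : Fin h, P.WO i * (P.WV i * X) * colwise σ ((P.WK i * X)ᵀ * (P.WQ i * X))

/-- Parameters of a Transformer block. -/
structure TFParams (m s h q : ℕ) where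
  attn : AttnParams m s h
  ff : FFParams m q

/-- Transformer block: `TF(X) = X' + FF(X')` (tokenwise), `X' = X + Attn(X)`. -/
def TFParams.apply {m s h q N : ℕ} (P : TFParams m s h q)
    (σ : (Fin N → ℝ) → (Fin N → ℝ)) (X : Matrix (Fin m) (Fin N) ℝ) :
    Matrix (Fin m) (Fin N) ℝ :=
  let X' := X + P.attn.apply σ X
  X' + Matrix.of fun i j => P.ff.apply (fun k => X' k j) i

/-- Softmax applied to a column. -/
def softmaxCol {N : ℕ} (v : Fin N → ℝ) : Fin N → ℝ :=
  fun i => Real.exp (v i) / ∑ j, Real.exp (v j)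

open Classical in
/-- Hardmax applied to a column: the one-hot indicator of the (least) index
achieving the maximal entry. -/
def hardmaxCol {N : ℕ} (v : Fin N → ℝ) : Fin N → ℝ :=
  fun i => if (∀ j, v j ≤ v i) ∧ (∀ j, v j = v i → i ≤ j) then 1 else 0

/-- Token-wise (column-wise) application of the affine map `x ↦ Ax + b`. -/
def affineCols {m d N : ℕ} (A : Matrix (Fin m) (Fin d) ℝ) (b : Fin m → ℝ)
    (X : Matrix (Fin d) (Fin N) ℝ) : Matrix (Fin m) (Fin N) ℝ :=
  Matrix.of fun i j => A.mulVec (fun k => X k j) i + b i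

/-- The input cube `[0,1]^{d×N}`. -/
def cube (d N : ℕ) : Set (Matrix (Fin d) (Fin N) ℝ) :=
  {X | ∀ i j, X i j ∈ Set.Icc (0 : ℝ) 1}

/-- Entrywise `p`-norm of a matrix. -/
def pNorm {d N : ℕ} (p : ℝ) (X : Matrix (Fin d) (Fin N) ℝ) : ℝ :=
  (∑ i, ∑ j, |X i j| ^ p) ^ (1 / p)

/-- Entrywise `p`-norm of a vector. -/
def vpNorm {d : ℕ} (p : ℝ) (x : Fin d → ℝ) : ℝ :=
  (∑ i, |x i| ^ p) ^ (1 / p)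

/-- Entrywise `2`-norm of a matrix. -/
def twoNorm {d N : ℕ} (X : Matrix (Fin d) (Fin N) ℝ) : ℝ :=
  Real.sqrt (∑ i, ∑ j, X i j ^ 2)

/-- Entrywise `2`-norm of a vector. -/
def vtwoNorm {d : ℕ} (x : Fin d → ℝ) : ℝ :=
  Real.sqrt (∑ i, x i ^ 2)

/-- Modulus of sequence continuity
`ω_f(δ) = sup{‖f(X)−f(X')‖_p : X, X' ∈ [0,1]^{d×N}, ‖X−X'‖₂ ≤ δ}`. -/
def modSeq {d N : ℕ} (p : ℝ)
    (f : Matrix (Fin d) (Fin N) ℝ → Matrix (Fin d) (Fin N) ℝ) (δ : ℝ) : ℝ :=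
  sSup {t | ∃ X ∈ cube d N, ∃ X' ∈ cube d N,
    twoNorm (X - X') ≤ δ ∧ t = pNorm p (f X - f X')}

/-- Modulus of contextual continuity `ω^cont_f`. -/
def modCtx {d N : ℕ} (p : ℝ)
    (f : Matrix (Fin d) (Fin N) ℝ → Matrix (Fin d) (Fin N) ℝ) (δ : ℝ) : ℝ :=
  sSup {t | ∃ n : Fin N, ∃ X ∈ cube d N, ∃ X' ∈ cube d N,
    twoNorm (X - X') ≤ δ ∧ (∀ i, X i n = X' i n) ∧
    t = vpNorm p (fun i => f X i n - f X' i n)}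

/-- Modulus of token continuity `ω^tok_f`. -/
def modTok {d N : ℕ} (p : ℝ)
    (f : Matrix (Fin d) (Fin N) ℝ → Matrix (Fin d) (Fin N) ℝ) (δ : ℝ) : ℝ :=
  sSup {t | ∃ n : Fin N, ∃ X ∈ cube d N, ∃ X' ∈ cube d N,
    vtwoNorm (fun i => X i n - X' i n) ≤ δ ∧
    (∀ q, q ≠ n → ∀ i, X i q = X' i q) ∧
    t = vpNorm p (fun i => f X i n - f X' i n)}

instance matrixMeasureSpace (d N : ℕ) :
    MeasureSpace (Matrix (Fin d) (Fin N) ℝ) :=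
  inferInstanceAs (MeasureSpace (Fin d → Fin N → ℝ))

/-- `L^p` norm of `g` over the cube `[0,1]^{d×N}`:
`(∫_{[0,1]^{d×N}} ‖g(X)‖_p^p dX)^{1/p}`. -/
def LpNormOn {d N : ℕ} (p : ℝ)
    (g : Matrix (Fin d) (Fin N) ℝ → Matrix (Fin d) (Fin N) ℝ) : ℝ :=
  (∫ X in cube d N, pNorm p (g X) ^ p) ^ (1 / p)

/-- Permutation equivariance on the cube: `f(XP) = f(X)P` for every
permutation matrix `P`, expressed via column permutations. -/
def PermEquivariant {d N : ℕ}
    (f : Matrix (Fin d) (Fin N) ℝ → Matrix (Fin d) (Fin N) ℝ) : Prop :=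
  ∀ σ : Equiv.Perm (Fin N), ∀ X ∈ cube d N,
    f (X.submatrix id σ) = (f X).submatrix id σ

/-- The looped network `L₂ ∘ TF^{∘r} ∘ L₁` with token-wise affine maps. -/
def loopedNet {d m N s h q : ℕ} (σ : (Fin N → ℝ) → (Fin N → ℝ))
    (P : TFParams m s h q)
    (A1 : Matrix (Fin m) (Fin d) ℝ) (b1 : Fin m → ℝ)
    (A2 : Matrix (Fin d) (Fin m) ℝ) (b2 : Fin d → ℝ) (r : ℕ)
    (X : Matrix (Fin d) (Fin N) ℝ) : Matrix (Fin d) (Fin N) ℝ :=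
  affineCols A2 b2 ((P.apply σ)^[r] (affineCols A1 b1 X))

end

theorem hardmaxCol_eq_single {N : ℕ} {v : Fin N → ℝ} {i : Fin N}
    (h : ∀ j, j ≠ i → v j < v i) : hardmaxCol v = Pi.single i 1 := by
  funext j
  by_cases hj : j = i
  · subst hj
    rw [Pi.single_eq_same, hardmaxCol, if_pos]
    refine ⟨fun k => ?_, fun k hk => ?_⟩
    · by_cases hk : k = j
      · rw [hk]
      · exact (h k hk).le
    · by_contra hlt
      exact (h k fun he => hlt he.ge).ne hk
  · rw [Pi.single_eq_of_ne hj, hardmaxCol, if_neg]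
    exact fun hmax => (h j hj).not_ge (hmax.1 i)

/-- The block extracting the largest remaining token. The rows hold the key of the token, the
accumulator, a buffer, the constant `1`, and an unused zero. -/
noncomputable def selectMax (K : ℝ) : TFParams 5 1 1 3 where
  attn :=
    { WO := fun _ => !![0; 0; 1; 0; 0]
      WV := fun _ => !![1, 0, 0, 0, 0]
      WK := fun _ => !![1, 0, 0, 0, 0]
      WQ := fun _ => !![0, 0, 0, 1, 0] }
  ff :=
    { W1 := !![1, 0, -1, 0, 0; 0, K - 1, 1, 0, 0; 0, 0, 1, 0, 0]
      W2 := !![-K, 0, 0; 0, 1, 0; 0, 0, -1; 0, 0, 0; 0, 0, 0]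
      b1 := ![1, 0, 0]
      b2 := 0 }

/-- The state in which the tokens have keys `key` and a common accumulator value `S`. -/
noncomputable def selectState {N : ℕ} (key : Fin N → ℝ) (S : ℝ) : Matrix (Fin 5) (Fin N) ℝ :=
  Matrix.of fun i j => ![key j, S, 0, 1, 0] i

theorem selectMax_attn_apply {N : ℕ} (K : ℝ) {key : Fin N → ℝ} (S : ℝ) {i : Fin N}
    (h : ∀ j, j ≠ i → key j < key i) :
    selectState key S + (selectMax K).attn.apply hardmaxCol (selectState key S) =
      Matrix.of fun l j => ![key j, S, key i, 1, 0] l := by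
  have hσ : colwise hardmaxCol
      (((selectMax K).attn.WK 0 * selectState key S)ᵀ *
        ((selectMax K).attn.WQ 0 * selectState key S)) =
      Matrix.of fun a _ => (Pi.single i 1 : Fin N → ℝ) a := by
    ext a b
    have hcol : (fun k => (((selectMax K).attn.WK 0 * selectState key S)ᵀ *
        ((selectMax K).attn.WQ 0 * selectState key S)) k b) = key := by
      funext k
      simp [selectMax, selectState, vecHead, vecTail, Matrix.mul_apply]
    simp only [colwise, Matrix.of_apply]
    rw [hcol, hardmaxCol_eq_single h]
  rw [AttnParams.apply, Fin.sum_univ_one, hσ]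
  ext l j
  fin_cases l <;>
    simp [selectMax, selectState, vecHead, vecMul, dotProduct, Pi.single_apply]

theorem selectMax_apply {N : ℕ} {K S : ℝ} {key : Fin N → ℝ} {i : Fin N} (hK : 1 ≤ K)
    (hS : 0 ≤ S) (hi : 0 ≤ key i) (h : ∀ j, j ≠ i → key j + 1 ≤ key i) :
    (selectMax K).apply hardmaxCol (selectState key S) =
      selectState (Function.update key i (key i - K)) (K * S + key i) := by
  have hacc : 0 ≤ (K - 1) * S + key i :=
    add_nonneg (mul_nonneg (sub_nonneg.2 hK) hS) hi
  rw [TFParams.apply, selectMax_attn_apply K S fun j hj => by linarith [h j hj]]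
  ext l j
  fin_cases l
  · by_cases hj : j = i
    · subst hj
      simp [selectMax, selectState, FFParams.apply, relu, Matrix.mulVec, dotProduct,
        Fin.sum_univ_succ]
      ring
    · have : key j + -key i + 1 ≤ 0 := by linarith [h j hj]
      simp [selectMax, selectState, FFParams.apply, relu, Matrix.mulVec, dotProduct,
        Fin.sum_univ_succ, hj, this]
  · simp [selectMax, selectState, FFParams.apply, relu, Matrix.mulVec, dotProduct,
      Fin.sum_univ_succ, hacc]
    ring
  all_goals
    simp [selectMax, selectState, FFParams.apply, relu, Matrix.mulVec, dotProduct,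
      Fin.sum_univ_succ, hi]

theorem iterate_selectMax {N K : ℕ} {z : Fin N → ℕ} (hz : ∀ n, z n < K) (hanti : StrictAnti z)
    {k : ℕ} (hk : k ≤ N) :
    ((selectMax K).apply hardmaxCol)^[k] (selectState (fun j => (z j : ℝ)) 0) =
      selectState (fun j => if (j : ℕ) < k then (z j : ℝ) - K else z j)
        (∑ n : Fin k, (z (Fin.castLE hk n) : ℝ) * (K : ℝ) ^ (k - 1 - (n : ℕ))) := by
  induction k with
  | zero => simp
  | succ k ih =>
    have hK : (1 : ℝ) ≤ K := by exact_mod_cast Nat.one_le_of_lt (hz ⟨k, hk⟩)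
    rw [Function.iterate_succ_apply', ih (Nat.le_of_succ_le hk),
      selectMax_apply (i := ⟨k, hk⟩) hK]
    · congr 1
      · funext j
        by_cases hj : j = ⟨k, hk⟩
        · subst hj
          simp
        · have : (j : ℕ) < k + 1 ↔ (j : ℕ) < k := by
            have : (j : ℕ) ≠ k := fun he => hj (Fin.ext he)
            omega
          simp [hj, this]
      · rw [Fin.sum_univ_castSucc, Finset.mul_sum]
        congr 1
        · refine Finset.sum_congr rfl fun n _ => ?_
          have : k + 1 - 1 - (n : ℕ) = k - 1 - (n : ℕ) + 1 := by omega
          rw [Fin.val_castSucc, this, pow_succ]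
          simp only [Fin.castLE_castSucc]
          ring
        · simp [Fin.castLE, Fin.last]
    · positivity
    · simp
    · intro j hj
      have hne : (j : ℕ) ≠ k := fun he => hj (Fin.ext he)
      simp only [lt_irrefl, if_false]
      split_ifs with hjk
      · have : (z j : ℝ) + 1 ≤ K := by exact_mod_cast hz j
        have : (0 : ℝ) ≤ z ⟨k, hk⟩ := Nat.cast_nonneg _
        linarith
      · have hlt : (⟨k, hk⟩ : Fin N) < j := Fin.lt_def.2 (by simp only; omega)
        exact_mod_cast hanti hlt

/-- contextual mapping: for `K ≥ N ≥ 1` there is a hardmax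
Transformer block `TF : ℝ^{5×N} → ℝ^{5×N}` with one head, head size 1, width 3
and token-wise affine maps `L₁ : ℝ → ℝ^5`, `L₂ : ℝ^5 → ℝ` such that for every
strictly decreasing `z ∈ {0,…,K−1}^N`, every output entry of
`L₂ ∘ TF^{∘N} ∘ L₁` applied to the row `zᵀ` equals `Σₙ zₙ·K^{N−n}`. -/
theorem contextual_mapping (N K : ℕ) (hN : 1 ≤ N) (hK : N ≤ K) :
    ∃ (P : TFParams 5 1 1 3) (a1 b1 : Fin 5 → ℝ) (a2 : Fin 5 → ℝ) (c2 : ℝ),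
      ∀ z : Fin N → ℕ, (∀ n, z n < K) →
        (∀ m n : Fin N, m < n → z n < z m) →
        ∀ j : Fin N,
          (∑ i, a2 i *
            ((P.apply hardmaxCol)^[N]
              (Matrix.of fun i j => a1 i * (z j : ℝ) + b1 i)) i j) + c2
            = ∑ n : Fin N, (z n : ℝ) * (K : ℝ) ^ (N - 1 - (n : ℕ)) := by
  refine ⟨selectMax K, ![1, 0, 0, 0, 0], ![0, 0, 0, 1, 0], ![0, 1, 0, 0, 0], 0,
    fun z hz hanti j => ?_⟩
  have hinit : (Matrix.of fun i j => (![1, 0, 0, 0, 0] : Fin 5 → ℝ) i * (z j : ℝ) +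
      (![0, 0, 0, 1, 0] : Fin 5 → ℝ) i) = selectState (fun j => (z j : ℝ)) 0 := by
    ext i j
    fin_cases i <;> simp [selectState]
  rw [hinit, iterate_selectMax hz (fun m n => hanti m n) le_rfl]
  simp [selectState, Fin.sum_univ_five]
end

section
/- Let N ∈ ℕ, N ≥ 1, let v ∈ ℝ^N with v_i ≥ 0 for all i, let n ∈ {1,…,N} with v_n = max_i v_i, let a ∈ ℝ^N satisfy a_j ≤ a_n − 1 for every j ≠ n, and let λ > 0. Define the softmax average g_S = Σ_{i=1}^N (exp(λa_i)/Σ_{j=1}^N exp(λa_j))·v_i. Then 0 ≤ v_n − g_S ≤ v_n · N · exp(−λ). -/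
/-- softmax error bound.  If `v ≥ 0`, `v n` is maximal, and
`a j ≤ a n − 1` for `j ≠ n`, then the softmax average `g_S` satisfies
`0 ≤ v n − g_S ≤ v n · N · exp(−λ)`. -/
theorem softmax_error_bound (N : ℕ) (hN : 1 ≤ N) (v : Fin N → ℝ)
    (hv : ∀ i, 0 ≤ v i) (n : Fin N) (hmax : ∀ i, v i ≤ v n)
    (a : Fin N → ℝ) (ha : ∀ j, j ≠ n → a j ≤ a n - 1)
    (lam : ℝ) (hlam : 0 < lam) :
    0 ≤ v n - (∑ i, (Real.exp (lam * a i) / ∑ j, Real.exp (lam * a j)) * v i) ∧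
    v n - (∑ i, (Real.exp (lam * a i) / ∑ j, Real.exp (lam * a j)) * v i)
      ≤ v n * N * Real.exp (-lam) := by
  have hle : ∀ i, Real.exp (lam * a i) ≤ ∑ j, Real.exp (lam * a j) := fun i =>
    Finset.single_le_sum (f := fun j => Real.exp (lam * a j))
      (fun j _ => (Real.exp_pos _).le) (Finset.mem_univ i)
  have hpos : 0 < ∑ j, Real.exp (lam * a j) := (Real.exp_pos _).trans_le (hle n)
  have hdiff : v n - (∑ i, (Real.exp (lam * a i) / ∑ j, Real.exp (lam * a j)) * v i)
      = ∑ i, (Real.exp (lam * a i) / ∑ j, Real.exp (lam * a j)) * (v n - v i) := by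
    simp only [mul_sub, Finset.sum_sub_distrib]
    rw [← Finset.sum_mul, ← Finset.sum_div, div_self hpos.ne', one_mul]
  rw [hdiff]
  constructor
  · exact Finset.sum_nonneg fun i _ =>
      mul_nonneg (div_nonneg (Real.exp_pos _).le hpos.le) (sub_nonneg.2 (hmax i))
  · have hterm : ∀ i, (Real.exp (lam * a i) / ∑ j, Real.exp (lam * a j)) * (v n - v i)
        ≤ Real.exp (-lam) * v n := by
      intro i
      by_cases hi : i = n
      · subst hi
        simpa using mul_nonneg (Real.exp_pos (-lam)).le (hv i)
      · have hweight : Real.exp (lam * a i) / ∑ j, Real.exp (lam * a j)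
            ≤ Real.exp (-lam) := by
          rw [div_le_iff₀ hpos]
          calc Real.exp (lam * a i) ≤ Real.exp (-lam + lam * a n) :=
                Real.exp_le_exp.2 (by nlinarith [ha i hi])
            _ = Real.exp (-lam) * Real.exp (lam * a n) := Real.exp_add _ _
            _ ≤ _ := mul_le_mul_of_nonneg_left (hle n) (Real.exp_pos _).le
        exact mul_le_mul hweight (sub_le_self _ (hv i)) (sub_nonneg.2 (hmax i))
          (Real.exp_pos _).le
    calc _ ≤ ∑ _i : Fin N, Real.exp (-lam) * v n := Finset.sum_le_sum fun i _ => hterm i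
      _ = v n * N * Real.exp (-lam) := by
        simp only [Finset.sum_const, Finset.card_univ, Fintype.card_fin, nsmul_eq_mul]
        ring
end
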